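/- Let a, b, c be real, let n ≥ k ≥ 0 be integers, and let (x,y) be real with x ≠ 1. Then: (2n+a+b+c+2)·P_{n,k}^{(a,b,c)}(x,y) = (n+k+a+b+c+2)·P_{n,k}^{(a+1,b,c)}(x,y) + (n+k+b+c+1)·P_{n−1,k}^{(a+1,b,c)}(x,y); (2n+a+b+c+2)(2k+b+c+1)·P_{n,k}^{(a,b,c)}(x,y) = (n+k+a+b+c+2)(k+b+c+1)·P_{n,k}^{(a,b+1,c)}(x,y) − (n−k+a)(k+b+c+1)·P_{n−1,k}^{(a,b+1,c)}(x,y) + (k+c)(n+k+b+c+1)·P_{n−1,k−1}^{(a,b+1,c)}(x,y) − (k+c)(n−k+1)·P_{n,k−1}^{(a,b+1,c)}(x,y); and (2n+a+b+c+2)(2k+b+c+1)·P_{n,k}^{(a,b,c)}(x,y) = (n+k+a+b+c+2)(k+b+c+1)·P_{n,k}^{(a,b,c+1)}(x,y) − (n−k+a)(k+b+c+1)·P_{n−1,k}^{(a,b,c+1)}(x,y) − (k+b)(n+k+b+c+1)·P_{n−1,k−1}^{(a,b,c+1)}(x,y) + (k+b)(n−k+1)·P_{n,k−1}^{(a,b,c+1)}(x,y).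 -/

import Mathlib

noncomputable section

/-- Generalized binomial coefficient `C(α, j) = α(α−1)⋯(α−j+1)/j!`. -/
def genBinom (α : ℝ) (j : ℕ) : ℝ :=
  (∏ i ∈ Finset.range j, (α - i)) / (Nat.factorial j)

/-- Jacobi polynomial `P_n^{(a,b)}(x)`; zero for negative `n`. -/
def jacobiP (n : ℤ) (a b : ℝ) (x : ℝ) : ℝ :=
  if n < 0 then 0 else
    ∑ m ∈ Finset.range (n.toNat + 1),
      genBinom ((n : ℝ) + a) (n.toNat - m) * genBinom ((n : ℝ) + b) m *
        ((x - 1) / 2) ^ m * ((x + 1) / 2) ^ (n.toNat - m)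

/-- Four-parameter Koornwinder polynomial `P_{n,k}^{(a,b,c,d)}(x,y)`;
zero whenever `k < 0`, `n < 0`, or `k > n` (covering the conventions
`k = −1`, `n = −1`, `k = n+1`). -/
def koornP (n k : ℤ) (a b c d : ℝ) (x y : ℝ) : ℝ :=
  if n < 0 ∨ k < 0 ∨ n < k then 0 else
    jacobiP (n - k) (2 * (k : ℝ) + b + c + d + 1) a (2 * x - 1) *
      (1 - x) ^ k.toNat * jacobiP k c b (-1 + 2 * y / (1 - x))

/-- The binomial series `(1 + vX)^α`. -/
def binomPS (α v : ℝ) : PowerSeries ℝ :=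
  PowerSeries.mk fun j => genBinom α j * v ^ j

lemma genBinom_zero (α : ℝ) : genBinom α 0 = 1 := by
  simp [genBinom]

lemma genBinom_succ_mul (α : ℝ) (j : ℕ) :
    genBinom α (j + 1) * ((j : ℝ) + 1) = genBinom α j * (α - j) := by
  have h1 : (j.factorial : ℝ) ≠ 0 := by positivity
  have h2 : (j : ℝ) + 1 ≠ 0 := by positivity
  simp only [genBinom, Finset.prod_range_succ, Nat.factorial_succ]
  push_cast
  field_simp

lemma genBinom_add_one_succ (α : ℝ) (j : ℕ) :
    genBinom (α + 1) (j + 1) * ((j : ℝ) + 1) = (α + 1) * genBinom α j := by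
  have h1 : (j.factorial : ℝ) ≠ 0 := by positivity
  have h2 : (j : ℝ) + 1 ≠ 0 := by positivity
  simp only [genBinom, Finset.prod_range_succ', Nat.factorial_succ]
  push_cast
  simp only [add_sub_add_right_eq_sub, sub_zero]
  field_simp

lemma genBinom_pascal (α : ℝ) (j : ℕ) :
    genBinom (α + 1) (j + 1) = genBinom α (j + 1) + genBinom α j := by
  have h2 : (j : ℝ) + 1 ≠ 0 := by positivity
  apply mul_right_cancel₀ h2
  linear_combination genBinom_add_one_succ α j - genBinom_succ_mul α j

lemma binomPS_add_one (α v : ℝ) :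
    binomPS (α + 1) v = (1 + PowerSeries.C v * PowerSeries.X) * binomPS α v := by
  ext j
  rw [add_mul, one_mul, mul_assoc, map_add, PowerSeries.coeff_C_mul]
  cases j with
  | zero => simp [binomPS, genBinom_zero]
  | succ j =>
    rw [PowerSeries.coeff_succ_X_mul]
    simp only [binomPS, PowerSeries.coeff_mk, genBinom_pascal]
    ring

lemma derivative_binomPS_add_one (α v : ℝ) :
    PowerSeries.derivative ℝ (binomPS (α + 1) v)
      = PowerSeries.C (v * (α + 1)) * binomPS α v := by
  ext j
  rw [PowerSeries.coeff_C_mul]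
  simp only [binomPS, PowerSeries.coeff_derivative, PowerSeries.coeff_mk]
  linear_combination v ^ (j + 1) * genBinom_add_one_succ α j

/-- The coefficient of `X ^ n` in `(1 + uX)^β (1 + vX)^α`. -/
def binomCoeff (n : ℕ) (α β u v : ℝ) : ℝ :=
  PowerSeries.coeff n (binomPS β u * binomPS α v)

lemma binomCoeff_zero (α β u v : ℝ) : binomCoeff 0 α β u v = 1 := by
  simp [binomCoeff, PowerSeries.coeff_mul, binomPS, genBinom_zero]

lemma binomCoeff_swap (n : ℕ) (α β u v : ℝ) :
    binomCoeff n α β u v = binomCoeff n β α v u := by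
  rw [binomCoeff, binomCoeff, mul_comm]

lemma binomCoeff_succ_add_one_left (n : ℕ) (α β u v : ℝ) :
    binomCoeff (n + 1) (α + 1) β u v
      = binomCoeff (n + 1) α β u v + v * binomCoeff n α β u v := by
  simp only [binomCoeff]
  rw [← PowerSeries.coeff_C_mul n, ← PowerSeries.coeff_succ_X_mul n, ← map_add,
    binomPS_add_one]
  congr 1
  ring

/-- The relation `v (1 + uX) = u (1 + vX) + (v - u)` on coefficients. -/
lemma binomCoeff_exchange (n : ℕ) (α β u v : ℝ) :
    v * binomCoeff n α (β + 1) u v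
      = u * binomCoeff n (α + 1) β u v + (v - u) * binomCoeff n α β u v := by
  simp only [binomCoeff]
  rw [← PowerSeries.coeff_C_mul, ← PowerSeries.coeff_C_mul, ← PowerSeries.coeff_C_mul,
    ← map_add, binomPS_add_one, binomPS_add_one, map_sub]
  congr 1
  ring

lemma binomCoeff_derivative (n : ℕ) (α β u v : ℝ) :
    ((n : ℝ) + 1) * binomCoeff (n + 1) (α + 1) (β + 1) u v
      = v * (α + 1) * binomCoeff n α (β + 1) u v
        + u * (β + 1) * binomCoeff n (α + 1) β u v := by
  simp only [binomCoeff]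
  rw [mul_comm, ← PowerSeries.coeff_derivative, Derivation.leibniz,
    derivative_binomPS_add_one, derivative_binomPS_add_one,
    ← PowerSeries.coeff_C_mul, ← PowerSeries.coeff_C_mul, ← map_add]
  congr 1
  simp only [smul_eq_mul]
  ring

lemma binomCoeff_raise (n : ℕ) (α β u v : ℝ) :
    (α + β + 1) * binomCoeff (n + 1) α β u v
      = (α + β - n) * binomCoeff (n + 1) (α + 1) β u v
        - (v - u) * β * binomCoeff n α (β - 1) u v := by
  obtain ⟨β, rfl⟩ : ∃ β', β = β' + 1 := ⟨β - 1, by ring⟩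
  rw [add_sub_cancel_right]
  linear_combination (-(α + β + 2)) * binomCoeff_succ_add_one_left n α (β + 1) u v
    + binomCoeff_derivative n α β u v - (β + 1) * binomCoeff_exchange n α β u v

lemma binomCoeff_lower (n : ℕ) (α β u v : ℝ) :
    (α + β + 1) * (-u) * binomCoeff n α β u v
      = (v - u) * α * binomCoeff n (α - 1) β u v
        - ((n : ℝ) + 1) * binomCoeff (n + 1) α (β + 1) u v := by
  obtain ⟨α, rfl⟩ : ∃ α', α = α' + 1 := ⟨α - 1, by ring⟩
  rw [add_sub_cancel_right]
  linear_combination binomCoeff_derivative n α β u v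
    + (α + 1) * binomCoeff_exchange n α β u v

lemma jacobiP_natCast (n : ℕ) (a b x : ℝ) :
    jacobiP n a b x = binomCoeff n (n + a) (n + b) ((x - 1) / 2) ((x + 1) / 2) := by
  rw [jacobiP, if_neg (by omega), binomCoeff, PowerSeries.coeff_mul,
    Finset.Nat.sum_antidiagonal_eq_sum_range_succ_mk]
  simp only [binomPS, PowerSeries.coeff_mk, Int.toNat_natCast, Int.cast_natCast]
  refine Finset.sum_congr rfl fun m _ => ?_
  ring

lemma jacobiP_of_neg {n : ℤ} (hn : n < 0) (a b x : ℝ) : jacobiP n a b x = 0 :=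
  if_pos hn

lemma jacobiP_zero (a b x : ℝ) : jacobiP 0 a b x = 1 := by
  simpa [binomCoeff_zero] using jacobiP_natCast 0 a b x

lemma jacobiP_raise_left {n : ℤ} (hn : 0 ≤ n) (a b x : ℝ) :
    (2 * (n : ℝ) + a + b + 1) * jacobiP n a b x
      = ((n : ℝ) + a + b + 1) * jacobiP n (a + 1) b x
        - ((n : ℝ) + b) * jacobiP (n - 1) (a + 1) b x := by
  lift n to ℕ using hn
  cases n with
  | zero => simp [jacobiP_zero, jacobiP_of_neg]
  | succ n =>
    rw [show ((n + 1 : ℕ) : ℤ) - 1 = (n : ℤ) by push_cast; ring]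
    simp only [jacobiP_natCast]
    have h := binomCoeff_raise n ((n + 1 : ℕ) + a) ((n + 1 : ℕ) + b) ((x - 1) / 2) ((x + 1) / 2)
    push_cast at h ⊢
    rw [show (n : ℝ) + (a + 1) = n + 1 + a by ring,
      show (n : ℝ) + b = n + 1 + b - 1 by ring,
      show (n : ℝ) + 1 + (a + 1) = n + 1 + a + 1 by ring]
    linear_combination h

lemma jacobiP_raise_right {n : ℤ} (hn : 0 ≤ n) (a b x : ℝ) :
    (2 * (n : ℝ) + a + b + 1) * jacobiP n a b x
      = ((n : ℝ) + a + b + 1) * jacobiP n a (b + 1) x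
        + ((n : ℝ) + a) * jacobiP (n - 1) a (b + 1) x := by
  lift n to ℕ using hn
  cases n with
  | zero => simp [jacobiP_zero, jacobiP_of_neg]
  | succ n =>
    rw [show ((n + 1 : ℕ) : ℤ) - 1 = (n : ℤ) by push_cast; ring]
    simp only [jacobiP_natCast, binomCoeff_swap _ _ _ ((x - 1) / 2)]
    have h := binomCoeff_raise n ((n + 1 : ℕ) + b) ((n + 1 : ℕ) + a) ((x + 1) / 2) ((x - 1) / 2)
    push_cast at h ⊢
    rw [show (n : ℝ) + (b + 1) = n + 1 + b by ring,
      show (n : ℝ) + a = n + 1 + a - 1 by ring,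
      show (n : ℝ) + 1 + (b + 1) = n + 1 + b + 1 by ring]
    linear_combination h

lemma jacobiP_lower_left {n : ℤ} (hn : 0 ≤ n) (a b x : ℝ) :
    (2 * (n : ℝ) + a + b + 1) * ((1 - x) / 2) * jacobiP n a b x
      = ((n : ℝ) + a) * jacobiP n (a - 1) b x
        - ((n : ℝ) + 1) * jacobiP (n + 1) (a - 1) b x := by
  lift n to ℕ using hn
  rw [show (n : ℤ) + 1 = ((n + 1 : ℕ) : ℤ) by push_cast; ring]
  simp only [jacobiP_natCast]
  have h := binomCoeff_lower n (n + a) (n + b) ((x - 1) / 2) ((x + 1) / 2)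
  push_cast at h ⊢
  rw [show (n : ℝ) + (a - 1) = n + a - 1 by ring,
    show (n : ℝ) + 1 + (a - 1) = n + a by ring,
    show (n : ℝ) + 1 + b = n + b + 1 by ring]
  linear_combination h

lemma koornP_eq (n k : ℤ) (a b c d x y : ℝ) :
    koornP n k a b c d x y
      = jacobiP (n - k) (2 * (k : ℝ) + b + c + d + 1) a (2 * x - 1) *
        (1 - x) ^ k.toNat * jacobiP k c b (-1 + 2 * y / (1 - x)) := by
  rw [koornP]
  split_ifs with h
  · rcases lt_or_ge k 0 with hk | hk
    · simp [jacobiP_of_neg hk]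
    · simp [jacobiP_of_neg (show n - k < 0 by omega)]
  · rfl

/-- Lowering the first parameter of the `x`-factor of a Koornwinder polynomial absorbs one
power of `1 - x`; for `k = 0` both sides vanish with the second Jacobi factor. -/
lemma jacobiP_lower_mul_pow {N k : ℤ} (hN : 0 ≤ N) (hk : 0 ≤ k) (s a b c x z : ℝ) :
    (2 * (N : ℝ) + s + a + 1) * jacobiP N s a (2 * x - 1) * (1 - x) ^ k.toNat
        * jacobiP (k - 1) b c z
      = (((N : ℝ) + s) * jacobiP N (s - 1) a (2 * x - 1)
          - ((N : ℝ) + 1) * jacobiP (N + 1) (s - 1) a (2 * x - 1))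
        * (1 - x) ^ (k - 1).toNat * jacobiP (k - 1) b c z := by
  rcases hk.eq_or_lt with rfl | hk
  · simp [jacobiP_of_neg]
  · rw [show k.toNat = (k - 1).toNat + 1 by omega, pow_succ]
    linear_combination (1 - x) ^ (k - 1).toNat * jacobiP (k - 1) b c z
      * jacobiP_lower_left hN s a (2 * x - 1)

theorem koorn_conversion (a b c : ℝ) (n k : ℤ) (hk : 0 ≤ k) (hnk : k ≤ n)
    (x y : ℝ) (hx : x ≠ 1) :
    ((2 * (n : ℝ) + a + b + c + 2) * koornP n k a b c 0 x y
      = ((n : ℝ) + (k : ℝ) + a + b + c + 2) * koornP n k (a + 1) b c 0 x y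
        + ((n : ℝ) + (k : ℝ) + b + c + 1) * koornP (n - 1) k (a + 1) b c 0 x y) ∧
    ((2 * (n : ℝ) + a + b + c + 2) * (2 * (k : ℝ) + b + c + 1)
          * koornP n k a b c 0 x y
      = ((n : ℝ) + (k : ℝ) + a + b + c + 2) * ((k : ℝ) + b + c + 1)
            * koornP n k a (b + 1) c 0 x y
        - ((n : ℝ) - (k : ℝ) + a) * ((k : ℝ) + b + c + 1)
            * koornP (n - 1) k a (b + 1) c 0 x y
        + ((k : ℝ) + c) * ((n : ℝ) + (k : ℝ) + b + c + 1)
            * koornP (n - 1) (k - 1) a (b + 1) c 0 x y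
        - ((k : ℝ) + c) * ((n : ℝ) - (k : ℝ) + 1)
            * koornP n (k - 1) a (b + 1) c 0 x y) ∧
    ((2 * (n : ℝ) + a + b + c + 2) * (2 * (k : ℝ) + b + c + 1)
          * koornP n k a b c 0 x y
      = ((n : ℝ) + (k : ℝ) + a + b + c + 2) * ((k : ℝ) + b + c + 1)
            * koornP n k a b (c + 1) 0 x y
        - ((n : ℝ) - (k : ℝ) + a) * ((k : ℝ) + b + c + 1)
            * koornP (n - 1) k a b (c + 1) 0 x y
        - ((k : ℝ) + b) * ((n : ℝ) + (k : ℝ) + b + c + 1)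
            * koornP (n - 1) (k - 1) a b (c + 1) 0 x y
        + ((k : ℝ) + b) * ((n : ℝ) - (k : ℝ) + 1)
            * koornP n (k - 1) a b (c + 1) 0 x y) := by
  have hN : 0 ≤ n - k := by omega
  set z : ℝ := -1 + 2 * y / (1 - x) with hz
  have e1 : n - 1 - k = n - k - 1 := by ring
  have e2 : n - 1 - (k - 1) = n - k := by ring
  have e3 : n - (k - 1) = n - k + 1 := by ring
  have hA := jacobiP_raise_left hN (2 * (k : ℝ) + b + c + 0 + 1) a (2 * x - 1)
  have hB := jacobiP_raise_right hN (2 * (k : ℝ) + b + c + 0 + 1) a (2 * x - 1)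
  simp only [koornP_eq, e1, e2, e3, ← hz]
  refine ⟨?_, ?_, ?_⟩
  · push_cast at hB ⊢
    linear_combination (1 - x) ^ k.toNat * jacobiP k c b z * hB
  · have hC := jacobiP_lower_mul_pow hN hk (2 * (k : ℝ) + b + c + 0 + 1) a c (b + 1) x z
    have hD := jacobiP_raise_right hk c b z
    push_cast at hA hC hD ⊢
    rw [show 2 * (k : ℝ) + (b + 1) + c + 0 + 1 = 2 * k + b + c + 0 + 1 + 1 by ring,
      show 2 * ((k : ℝ) - 1) + (b + 1) + c + 0 + 1 = 2 * k + b + c + 0 + 1 - 1 by ring]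
    linear_combination
      (2 * (n : ℝ) + a + b + c + 2) * jacobiP (n - k) (2 * (k : ℝ) + b + c + 0 + 1) a (2 * x - 1)
        * (1 - x) ^ k.toNat * hD
      + (k + b + c + 1) * (1 - x) ^ k.toNat * jacobiP k c (b + 1) z * hA
      + (k + c) * hC
  · have hC := jacobiP_lower_mul_pow hN hk (2 * (k : ℝ) + b + c + 0 + 1) a (c + 1) b x z
    have hD := jacobiP_raise_left hk c b z
    push_cast at hA hC hD ⊢
    rw [show 2 * (k : ℝ) + b + (c + 1) + 0 + 1 = 2 * k + b + c + 0 + 1 + 1 by ring,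
      show 2 * ((k : ℝ) - 1) + b + (c + 1) + 0 + 1 = 2 * k + b + c + 0 + 1 - 1 by ring]
    linear_combination
      (2 * (n : ℝ) + a + b + c + 2) * jacobiP (n - k) (2 * (k : ℝ) + b + c + 0 + 1) a (2 * x - 1)
        * (1 - x) ^ k.toNat * hD
      + (k + b + c + 1) * (1 - x) ^ k.toNat * jacobiP k (c + 1) b z * hA
      - (k + b) * hC
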